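/- Let p be prime, q = p^h, m ≥ m₁ ≥ 1, and let f₁,…,f_s ∈ ℤ_q[x₁,…,x_n] be nonconstant with m₁ = 1. Let 𝓣_m ⊆ ℤ_q^n be the Teichmüller box of level m and V = {X ∈ 𝓣_m : f_k(X) ≡ 0 mod p for all k ∈ [1,s]}. Then ord_q(|V|) ≥ ⌈(n − Σ_{k=1}^s deg f_k)/max_k deg f_k⌉* + n(m−1). -/

import Mathlib

/-- Digit sum of `a` in base `q`. -/
def axkDig (q a : ℕ) : ℕ := (Nat.digits q a).sum

lemma axkDig_zero (q : ℕ) : axkDig q 0 = 0 := by simp [axkDig]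

lemma axkDig_rec {q : ℕ} (hq : 1 < q) (a : ℕ) : axkDig q a = a % q + axkDig q (a / q) := by
  rcases Nat.eq_zero_or_pos a with rfl | ha
  · simp [axkDig]
  · unfold axkDig
    rw [Nat.digits_def' hq ha, List.sum_cons]

lemma axkDig_le (q a : ℕ) : axkDig q a ≤ a := Nat.digit_sum_le q a

lemma axkDig_mul_self {q : ℕ} (hq : 1 < q) (a : ℕ) : axkDig q (q * a) = axkDig q a := by
  rw [axkDig_rec hq, Nat.mul_mod_right, Nat.mul_div_cancel_left _ (by omega), zero_add]

lemma axkDig_of_lt {q a : ℕ} (hq : 1 < q) (ha : a < q) : axkDig q a = a := by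
  rw [axkDig_rec hq, Nat.mod_eq_of_lt ha, Nat.div_eq_of_lt ha, axkDig_zero, add_zero]

lemma axkDig_add_le {q : ℕ} (hq : 1 < q) (a b : ℕ) :
    axkDig q (a + b) ≤ axkDig q a + axkDig q b := by
  have one_le : ∀ n, axkDig q (n + 1) ≤ axkDig q n + 1 := by
    intro n
    induction n using Nat.strong_induction_on with
    | _ n ih =>
      by_cases h : n % q + 1 < q
      · have h1 : (n + 1) % q = n % q + 1 := by
          rw [Nat.add_mod, Nat.mod_eq_of_lt hq, Nat.mod_eq_of_lt h]
        have h2 : (n + 1) / q = n / q := by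
          rw [Nat.add_div (by omega), Nat.mod_eq_of_lt hq, if_neg (by omega), Nat.div_eq_of_lt hq]
          omega
        rw [axkDig_rec hq (n + 1), h1, h2, axkDig_rec hq n]
        omega
      · have hlt := Nat.mod_lt n (show 0 < q by omega)
        have h2 : (n + 1) / q = n / q + 1 := by
          rw [Nat.add_div (by omega), Nat.mod_eq_of_lt hq, if_pos (by omega), Nat.div_eq_of_lt hq]
        have h1 : (n + 1) % q = 0 := by
          have := Nat.div_add_mod (n + 1) q
          have h3 := Nat.div_add_mod n q
          rw [h2, mul_add] at this
          omega
        have hn : 0 < n := by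
          rcases Nat.eq_zero_or_pos n with rfl | h0
          · simp at h; omega
          · exact h0
        have := ih (n / q) (Nat.div_lt_self hn hq)
        rw [axkDig_rec hq (n + 1), h1, h2, axkDig_rec hq n]
        omega
  induction a using Nat.strong_induction_on generalizing b with
  | _ a ih =>
    rcases Nat.eq_zero_or_pos a with rfl | ha
    · simp [axkDig]
    · have ih1 := fun b => ih (a / q) (Nat.div_lt_self ha hq) b
      have hadd : (a + b) / q = a / q + b / q + if q ≤ a % q + b % q then 1 else 0 :=
        Nat.add_div (by omega)
      have e1 := Nat.div_add_mod (a + b) q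
      have e2 := Nat.div_add_mod a q
      have e3 := Nat.div_add_mod b q
      have hi := ih1 (b / q)
      have ho := one_le (a / q + b / q)
      rw [axkDig_rec hq (a + b), axkDig_rec hq a, axkDig_rec hq b]
      rw [hadd] at e1 ⊢
      split_ifs at * with h
      · simp only [mul_add] at e1
        omega
      · simp only [mul_add, add_zero] at e1 ⊢
        omega

lemma axkDig_sum_le {q : ℕ} (hq : 1 < q) {ι : Type*} (s : Finset ι) (a : ι → ℕ) :
    axkDig q (∑ i ∈ s, a i) ≤ ∑ i ∈ s, axkDig q (a i) := by
  classical
  induction s using Finset.induction_on with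
  | empty => simp [axkDig]
  | insert i s hi ih =>
    rw [Finset.sum_insert hi, Finset.sum_insert hi]
    exact (axkDig_add_le hq _ _).trans (by omega)

lemma axkDig_mul_le {q : ℕ} (hq : 1 < q) (c a : ℕ) :
    axkDig q (c * a) ≤ c * axkDig q a := by
  have := axkDig_sum_le hq (Finset.range c) (fun _ => a)
  simpa using this

lemma axkDig_modEq (q a : ℕ) : (q - 1) ∣ a - axkDig q a :=
  ⟨_, (Nat.sub_one_mul_sum_log_div_pow_eq_sub_sum_digits a).symm⟩

lemma axkDig_pos {q a : ℕ} (ha : 0 < a) : 0 < axkDig q a := by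
  unfold axkDig
  have hnil : q.digits a ≠ [] := Nat.digits_ne_nil_iff_ne_zero.mpr ha.ne'
  exact List.sum_pos_iff_exists_pos_nat.mpr
    ⟨_, List.getLast_mem hnil, Nat.pos_of_ne_zero (Nat.getLast_digit_ne_zero q ha.ne')⟩

lemma axkDig_dvd {q a : ℕ} (h : (q - 1) ∣ a) : (q - 1) ∣ axkDig q a := by
  have h1 := axkDig_modEq q a
  have h2 := axkDig_le q a
  have := Nat.dvd_sub h h1
  rwa [Nat.sub_sub_self h2] at this

lemma axkDig_no_carry {q d x y : ℕ} (hq : 1 < q) (hdq : d ∣ q) (hdx : d ∣ x) (hy : y < d) :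
    axkDig q (x + y) = axkDig q x + y := by
  have hr : d ∣ x % q := (Nat.dvd_mod_iff hdq).2 hdx
  have hlt := Nat.mod_lt x (show 0 < q by omega)
  have hlt2 : x % q + y < q := by
    obtain ⟨u, hu⟩ := hr
    obtain ⟨v, hv⟩ := hdq
    rw [hu] at hlt ⊢
    have : u < v := by
      rw [hv] at hlt
      exact lt_of_mul_lt_mul_left hlt (Nat.zero_le _)
    have h3 : d * (u + 1) ≤ d * v := Nat.mul_le_mul_left _ this
    rw [mul_add, mul_one, ← hv] at h3
    omega
  have hyq : y < q := by omega
  have h1 : (x + y) % q = x % q + y := by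
    rw [Nat.add_mod, Nat.mod_eq_of_lt hyq, Nat.mod_eq_of_lt hlt2]
  have h2 : (x + y) / q = x / q := by
    rw [Nat.add_div (by omega), Nat.mod_eq_of_lt hyq, if_neg (by omega), Nat.div_eq_of_lt hyq]
    omega
  rw [axkDig_rec hq (x + y), h1, h2, axkDig_rec hq x]
  omega

lemma axkDig_shift {p h : ℕ} (hp : 1 < p) (hh : 0 < h) (a : ℕ) :
    (p - 1) * ∑ i ∈ Finset.range h, axkDig (p ^ h) (p ^ i * a) = (p ^ h - 1) * axkDig p a := by
  have hq : 1 < p ^ h := Nat.one_lt_pow hh.ne' hp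
  induction a using Nat.strong_induction_on with
  | _ a ih =>
    rcases Nat.eq_zero_or_pos a with rfl | ha
    · simp [axkDig]
    · have key : ∀ i ∈ Finset.range h, axkDig (p ^ h) (p ^ i * a) =
          axkDig (p ^ h) (p ^ (i + 1) * (a / p)) + p ^ i * (a % p) := by
        intro i hi
        rw [Finset.mem_range] at hi
        have : p ^ i * a = p ^ (i + 1) * (a / p) + p ^ i * (a % p) := by
          conv_lhs => rw [← Nat.div_add_mod a p]
          ring
        rw [this]
        refine axkDig_no_carry (d := p ^ (i + 1)) hq (pow_dvd_pow _ hi) (Dvd.intro _ rfl) ?_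
        rw [pow_succ]
        exact Nat.mul_lt_mul_of_pos_left (Nat.mod_lt _ (by omega)) (by positivity)
      have hgeom : (p - 1) * ∑ i ∈ Finset.range h, p ^ i = p ^ h - 1 := by
        have h1 : 1 ≤ p ^ h := hq.le
        zify [hp.le, h1]
        exact mul_geom_sum _ _
      have hsh : ∑ i ∈ Finset.range h, axkDig (p ^ h) (p ^ (i + 1) * (a / p)) =
          ∑ i ∈ Finset.range h, axkDig (p ^ h) (p ^ i * (a / p)) := by
        have h1 := Finset.sum_range_succ (fun i => axkDig (p ^ h) (p ^ i * (a / p))) h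
        have h2 := Finset.sum_range_succ' (fun i => axkDig (p ^ h) (p ^ i * (a / p))) h
        simp only [pow_zero, one_mul, axkDig_mul_self hq] at h1 h2
        omega
      rw [Finset.sum_congr rfl key, Finset.sum_add_distrib, hsh, mul_add,
        ih _ (Nat.div_lt_self ha hp), ← Finset.sum_mul, ← mul_assoc, hgeom, ← mul_add,
        axkDig_rec hp a, add_comm]

lemma axkDig_pow_sub_one {p : ℕ} (hp : 1 < p) (h M : ℕ) :
    axkDig p ((p ^ h - 1) * p ^ M) ≤ h * (p - 1) := by
  induction M with
  | zero =>
    rw [pow_zero, mul_one]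
    induction h with
    | zero => simp [axkDig]
    | succ h ih =>
      have h1 : 1 ≤ p ^ h := Nat.one_le_pow _ _ (by omega)
      have : p ^ (h + 1) - 1 = p * (p ^ h - 1) + (p - 1) := by
        rw [Nat.mul_sub, mul_one, pow_succ, mul_comm]
        have := Nat.mul_le_mul_left p h1
        omega
      rw [this, add_mul, one_mul]
      refine (axkDig_add_le hp _ _).trans ?_
      rw [axkDig_mul_self hp, axkDig_of_lt (a := p - 1) hp (by omega)]
      omega
  | succ M ih =>
    rw [pow_succ, ← mul_assoc, mul_comm _ p, axkDig_mul_self hp]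
    exact ih

/-- Valuation of a multinomial coefficient via digit sums. -/
lemma axk_multinomial {p : ℕ} [Fact p.Prime] {α : Type*} (s : Finset α) (g : α → ℕ) :
    (p - 1) * padicValNat p (Nat.multinomial s g) + axkDig p (∑ i ∈ s, g i) =
      ∑ i ∈ s, axkDig p (g i) := by
  have hfac : ∀ n : ℕ, (p - 1) * padicValNat p n.factorial + axkDig p n = n := by
    intro n
    rw [sub_one_mul_padicValNat_factorial]
    exact Nat.sub_add_cancel (axkDig_le p n)
  have hspec := Nat.multinomial_spec s g
  have hprod : padicValNat p (∏ i ∈ s, (g i).factorial) =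
      ∑ i ∈ s, padicValNat p (g i).factorial := by
    classical
    clear hspec
    induction s using Finset.induction_on with
    | empty => simp
    | insert a s ha ih =>
      rw [Finset.prod_insert ha, Finset.sum_insert ha, padicValNat.mul (Nat.factorial_ne_zero _)
        (Finset.prod_ne_zero_iff.2 fun i _ => Nat.factorial_ne_zero _), ih]
  have h1 : padicValNat p (∑ i ∈ s, g i).factorial =
      ∑ i ∈ s, padicValNat p (g i).factorial + padicValNat p (Nat.multinomial s g) := by
    rw [← hspec, padicValNat.mul (Finset.prod_ne_zero_iff.2 fun i _ => Nat.factorial_ne_zero _)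
      (Nat.multinomial_pos s g).ne', hprod]
  have h2 := hfac (∑ i ∈ s, g i)
  have h3 : ∑ i ∈ s, ((p - 1) * padicValNat p (g i).factorial + axkDig p (g i)) =
    ∑ i ∈ s, g i := Finset.sum_congr rfl fun i _ => hfac (g i)
  rw [Finset.sum_add_distrib, ← Finset.mul_sum] at h3
  rw [h1, mul_add] at h2
  omega

lemma axk_term {p h : ℕ} [Fact p.Prime] (hh : 0 < h) {ι : Type*} [Fintype ι] {n : ℕ}
    (d : ι → ℕ) (D : ℕ) (hD1 : 1 ≤ D) (hD : ∀ k, d k ≤ D)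
    (supp : ι → Finset (Fin n →₀ ℕ)) (hsupp : ∀ k, ∀ w ∈ supp k, ∑ l, w l ≤ d k)
    (M : ℕ) (φ : ι → (Fin n →₀ ℕ) → ℕ)
    (hφ : ∀ k, ∑ w ∈ supp k, φ k w = (p ^ h - 1) * p ^ M)
    (e : Fin n → ℕ) (he : ∀ l, e l = ∑ k, ∑ w ∈ supp k, w l * φ k w)
    (hdvd : ∀ l, (p ^ h - 1) ∣ e l)
    (μ : ℕ) (hμ : ∀ t, n ≤ ∑ k, d k + D * t → μ ≤ t) :
    h * μ ≤ h * (Finset.univ.filter fun l => e l = 0).card +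
      ∑ k, padicValNat p (Nat.multinomial (supp k) (φ k)) := by
  have hp : 1 < p := (Fact.out : p.Prime).one_lt
  have hq : 1 < p ^ h := Nat.one_lt_pow hh.ne' hp
  set q := p ^ h with hqdef
  have hq1 : 0 < q - 1 := by omega
  set z := (Finset.univ.filter fun l => e l = 0).card with hz
  have hU : ∀ k i, ∃ T, ∑ w ∈ supp k, axkDig q (p ^ i * φ k w) = (q - 1) * (T + 1) := by
    intro k i
    have h1 : (q - 1) ∣ ∑ w ∈ supp k, axkDig q (p ^ i * φ k w) := by
      have h2 : (q - 1) ∣ ∑ w ∈ supp k, (p ^ i * φ k w - axkDig q (p ^ i * φ k w)) :=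
        Finset.dvd_sum fun w _ => axkDig_modEq q _
      have h3 : (q - 1) ∣ ∑ w ∈ supp k, p ^ i * φ k w := by
        rw [← Finset.mul_sum, hφ]
        exact Dvd.dvd.mul_left (Dvd.intro _ rfl) _
      have h4 : ∑ w ∈ supp k, (p ^ i * φ k w - axkDig q (p ^ i * φ k w)) +
          ∑ w ∈ supp k, axkDig q (p ^ i * φ k w) = ∑ w ∈ supp k, p ^ i * φ k w := by
        rw [← Finset.sum_add_distrib]
        exact Finset.sum_congr rfl fun w _ => Nat.sub_add_cancel (axkDig_le _ _)
      exact (Nat.dvd_add_right h2).1 (h4 ▸ h3)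
    obtain ⟨T, hT⟩ := h1
    have hpos : 0 < ∑ w ∈ supp k, axkDig q (p ^ i * φ k w) := by
      have h5 : 0 < ∑ w ∈ supp k, φ k w := by rw [hφ]; positivity
      obtain ⟨w, hw, hw0⟩ := Finset.exists_ne_zero_of_sum_ne_zero h5.ne'
      refine lt_of_lt_of_le (axkDig_pos (q := q) (a := p ^ i * φ k w) ?_)
        (Finset.single_le_sum (f := fun w => axkDig q (p ^ i * φ k w))
          (fun _ _ => Nat.zero_le _) hw)
      have := Nat.pos_of_ne_zero hw0
      positivity
    rcases T with _ | T
    · rw [hT, mul_zero] at hpos; exact absurd hpos (lt_irrefl _)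
    · exact ⟨T, hT⟩
  choose T hT using hU
  -- valuation of multinomials
  have hv : ∀ k, ∑ i ∈ Finset.range h, T k i ≤
      padicValNat p (Nat.multinomial (supp k) (φ k)) := by
    intro k
    have h1 := axk_multinomial (p := p) (supp k) (φ k)
    have h2 := axkDig_pow_sub_one hp h M
    rw [← hqdef] at h2
    rw [hφ] at h1
    set v := padicValNat p (Nat.multinomial (supp k) (φ k))
    have h3 : ∑ w ∈ supp k, axkDig p (φ k w) ≤ (p - 1) * (v + h) := by
      rw [mul_add, mul_comm (p - 1) h]; omega
    have h4 : (q - 1) * ∑ w ∈ supp k, axkDig p (φ k w) =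
        (p - 1) * ∑ i ∈ Finset.range h, (q - 1) * (T k i + 1) := by
      rw [Finset.mul_sum]
      simp_rw [← hT]
      rw [Finset.sum_comm, Finset.mul_sum]
      exact Finset.sum_congr rfl fun w _ => (axkDig_shift hp hh _).symm
    have h5 := Nat.mul_le_mul_left (q - 1) h3
    rw [h4, ← Finset.mul_sum, Finset.sum_add_distrib] at h5
    simp only [Finset.sum_const, Finset.card_range, smul_eq_mul, mul_one] at h5
    have h6 : ((q - 1) * (p - 1)) * (∑ i ∈ Finset.range h, T k i + h) ≤
      ((q - 1) * (p - 1)) * (v + h) := by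
      calc _ = (p - 1) * ((q - 1) * (∑ i ∈ Finset.range h, T k i + h)) := by ring
        _ ≤ _ := h5
        _ = _ := by ring
    have hp1 : 0 < p - 1 := by omega
    have := Nat.le_of_mul_le_mul_left h6 (by positivity)
    omega
  have hi : ∀ i, μ ≤ z + ∑ k, T k i := by
    intro i
    apply hμ
    have hcard : (Finset.univ.filter fun l => e l ≠ 0).card + z = n := by
      have := Finset.card_filter_add_card_filter_not (s := (Finset.univ : Finset (Fin n)))
        (fun l => e l = 0)
      rw [Finset.card_fin] at this
      rw [add_comm]
      exact this
    have h1 : (q - 1) * (Finset.univ.filter fun l => e l ≠ 0).card ≤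
        ∑ l, axkDig q (p ^ i * e l) := by
      calc _ = ∑ l ∈ Finset.univ.filter fun l => e l ≠ 0, (q - 1) := by
            rw [Finset.sum_const, smul_eq_mul, mul_comm]
        _ ≤ ∑ l ∈ Finset.univ.filter fun l => e l ≠ 0, axkDig q (p ^ i * e l) := by
            refine Finset.sum_le_sum fun l hl => ?_
            have hl0 := Nat.pos_of_ne_zero (Finset.mem_filter.1 hl).2
            exact Nat.le_of_dvd (axkDig_pos (by positivity))
              (axkDig_dvd (Dvd.dvd.mul_left (hdvd l) _))
        _ ≤ _ := Finset.sum_le_sum_of_subset (Finset.subset_univ _)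
    have h2 : ∑ l, axkDig q (p ^ i * e l) ≤ ∑ k, d k * ((q - 1) * (T k i + 1)) := by
      calc ∑ l, axkDig q (p ^ i * e l)
          ≤ ∑ l, ∑ k, ∑ w ∈ supp k, w l * axkDig q (p ^ i * φ k w) := by
            refine Finset.sum_le_sum fun l _ => ?_
            rw [he, Finset.mul_sum]
            refine (axkDig_sum_le hq _ _).trans (Finset.sum_le_sum fun k _ => ?_)
            rw [Finset.mul_sum]
            refine (axkDig_sum_le hq _ _).trans (Finset.sum_le_sum fun w _ => ?_)
            rw [mul_left_comm]
            exact axkDig_mul_le hq _ _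
        _ = ∑ k, ∑ w ∈ supp k, (∑ l, w l) * axkDig q (p ^ i * φ k w) := by
            rw [Finset.sum_comm]
            refine Finset.sum_congr rfl fun k _ => ?_
            rw [Finset.sum_comm]
            exact Finset.sum_congr rfl fun w _ => (Finset.sum_mul _ _ _).symm
        _ ≤ _ := by
            refine Finset.sum_le_sum fun k _ => ?_
            rw [← hT, Finset.mul_sum]
            exact Finset.sum_le_sum fun w hw => Nat.mul_le_mul_right _ (hsupp k w hw)
    have h3 : (q - 1) * (Finset.univ.filter fun l => e l ≠ 0).card ≤
        (q - 1) * ∑ k, d k * (T k i + 1) := by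
      refine (h1.trans h2).trans (le_of_eq ?_)
      rw [Finset.mul_sum]
      exact Finset.sum_congr rfl fun k _ => by ring
    have h4 := Nat.le_of_mul_le_mul_left h3 hq1
    simp only [mul_add, mul_one, Finset.sum_add_distrib] at h4
    have h5 : ∑ k, d k * T k i ≤ D * ∑ k, T k i := by
      rw [Finset.mul_sum]
      exact Finset.sum_le_sum fun k _ => Nat.mul_le_mul_right _ (hD k)
    have h6 : z ≤ D * z := Nat.le_mul_of_pos_left _ hD1
    rw [mul_add]
    omega
  calc h * μ = ∑ i ∈ Finset.range h, μ := by simp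
    _ ≤ ∑ i ∈ Finset.range h, (z + ∑ k, T k i) := Finset.sum_le_sum fun i _ => hi i
    _ = h * z + ∑ k, ∑ i ∈ Finset.range h, T k i := by
        rw [Finset.sum_add_distrib, Finset.sum_comm]; simp
    _ ≤ _ := by
        gcongr with k _
        exact hv k

/-- Power sums over Teichmüller representatives. -/
lemma axk_powsum {K W : Type*} [Field K] [Fintype K] [CommRing W] [IsDomain W]
    (τ : K →* W) (hinj : Function.Injective τ) (e : ℕ)
    (hne : ¬ (Fintype.card K - 1) ∣ e) : ∑ a : K, τ a ^ e = 0 := by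
  have : ¬ ∀ x : Kˣ, x ^ e = 1 := by
    rw [FiniteField.forall_pow_eq_one_iff]; exact hne
  push Not at this
  obtain ⟨g, hg⟩ := this
  have h1 : ∑ a : K, τ a ^ e = τ g ^ e * ∑ a : K, τ a ^ e := by
    rw [Finset.mul_sum]
    symm
    refine Fintype.sum_equiv (Units.mulLeft g) _ _ fun a => ?_
    simp [mul_pow]
  have h2 : τ g ^ e ≠ 1 := by
    intro h
    apply hg
    rw [← map_pow, ← map_one τ] at h
    exact Units.ext (by simpa using hinj h)
  have h3 : (τ g ^ e - 1) * ∑ a : K, τ a ^ e = 0 := by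
    rw [sub_mul, ← h1, one_mul, sub_self]
  exact (mul_eq_zero.1 h3).resolve_left (sub_ne_zero.2 h2)

lemma axk_sum {p h : ℕ} [Fact p.Prime] (hh : 0 < h) {K W : Type*} [Field K] [Fintype K]
    (hK : Fintype.card K = p ^ h) [CommRing W] [IsDomain W]
    (τ : K →* W) (hinj : Function.Injective τ)
    {ι : Type*} [Fintype ι] {n : ℕ} (f : ι → MvPolynomial (Fin n) W)
    (D : ℕ) (hD1 : 1 ≤ D) (hD : ∀ k, (f k).totalDegree ≤ D) (M : ℕ)
    (μ : ℕ) (hμ : ∀ t, n ≤ ∑ k, (f k).totalDegree + D * t → μ ≤ t) :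
    (p : W) ^ (h * μ) ∣ ∑ x : Fin n → K,
      ∏ k, (MvPolynomial.eval (fun l => τ (x l)) (f k)) ^ ((p ^ h - 1) * p ^ M) := by
  classical
  simp_rw [MvPolynomial.eval_eq', Finset.sum_pow_eq_sum_piAntidiag, Finset.prod_univ_sum]
  rw [Finset.sum_comm]
  refine Finset.dvd_sum fun φ hφ => ?_
  rw [Fintype.mem_piFinset] at hφ
  have hφ' : ∀ k, ∑ w ∈ (f k).support, φ k w = (p ^ h - 1) * p ^ M :=
    fun k => (Finset.mem_piAntidiag.1 (hφ k)).1
  set e : Fin n → ℕ := fun l => ∑ k, ∑ w ∈ (f k).support, w l * φ k w with he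
  have hterm : ∀ x : Fin n → K,
      (∏ k, ((Nat.multinomial (f k).support (φ k) : W) * ∏ w ∈ (f k).support,
        (MvPolynomial.coeff w (f k) * ∏ l, τ (x l) ^ w l) ^ φ k w)) =
      (∏ k, (Nat.multinomial (f k).support (φ k) : W)) *
        (∏ k, ∏ w ∈ (f k).support, MvPolynomial.coeff w (f k) ^ φ k w) *
          ∏ l, τ (x l) ^ e l := by
    intro x
    rw [Finset.prod_mul_distrib, mul_assoc]
    congr 1
    simp_rw [mul_pow, Finset.prod_mul_distrib]
    congr 1
    simp_rw [he, ← Finset.prod_pow_eq_pow_sum, ← Finset.prod_pow, ← pow_mul]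
    conv_rhs => rw [Finset.prod_comm]
    refine Finset.prod_congr rfl fun k _ => ?_
    rw [Finset.prod_comm]
  simp_rw [hterm]
  rw [← Finset.mul_sum]
  have hps : ∑ x : Fin n → K, ∏ l, τ (x l) ^ e l = ∏ l, ∑ a : K, τ a ^ e l := by
    rw [Finset.prod_univ_sum, Fintype.piFinset_univ]
  rw [hps]
  by_cases hd : ∀ l, (p ^ h - 1) ∣ e l
  · have hmain := axk_term (p := p) hh (fun k => (f k).totalDegree) D hD1 hD
      (fun k => (f k).support) (fun k w hw => by
        have := MvPolynomial.le_totalDegree hw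
        rwa [Finsupp.sum_fintype _ _ (fun _ => rfl)] at this) M φ hφ' e (fun l => rfl) hd μ hμ
    refine (pow_dvd_pow _ hmain).trans ?_
    rw [add_comm, pow_add]
    refine mul_dvd_mul (Dvd.dvd.mul_right ?_ _) ?_
    · rw [← Finset.prod_pow_eq_pow_sum]
      refine Finset.prod_dvd_prod_of_dvd _ _ fun k _ => ?_
      have := (pow_padicValNat_dvd (p := p) (n := Nat.multinomial (f k).support (φ k)))
      exact_mod_cast Nat.cast_dvd_cast (α := W) this
    · have h1 : (p : W) ^ (h * (Finset.univ.filter fun l => e l = 0).card) =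
          ∏ l, (if e l = 0 then (p : W) ^ h else 1) := by
        rw [← Finset.prod_filter, Finset.prod_const, pow_mul]
      rw [h1]
      refine Finset.prod_dvd_prod_of_dvd _ _ fun l _ => ?_
      split_ifs with h0
      · simp [h0, hK]
      · exact one_dvd _
  · push Not at hd
    obtain ⟨l, hl⟩ := hd
    rw [Finset.prod_eq_zero (Finset.mem_univ l)
      (axk_powsum τ hinj (e l) (by rwa [hK])), mul_zero]
    exact dvd_zero _

/-- The Ax–Katz theorem, in terms of Teichmüller lifts. -/
lemma axk_main {p h : ℕ} [Fact p.Prime] (hh : 0 < h) {K W : Type*} [Field K] [Fintype K]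
    (hK : Fintype.card K = p ^ h) [CommRing W] [IsDomain W] (hpW : (p : W) ≠ 0)
    (τ : K →* W) (π : W →+* K) (hπτ : ∀ a, π (τ a) = a) (hπ : ∀ x, π x = 0 ↔ (p : W) ∣ x)
    {s n : ℕ} (f : Fin s → MvPolynomial (Fin n) W)
    (D : ℕ) (hD1 : 1 ≤ D) (hD : ∀ k, (f k).totalDegree ≤ D)
    (μ : ℕ) (hμ : ∀ t, n ≤ ∑ k, (f k).totalDegree + D * t → μ ≤ t) :
    (p ^ h) ^ μ ∣ Nat.card {x : Fin n → K //
      ∀ k, (p : W) ∣ MvPolynomial.eval (fun l => τ (x l)) (f k)} := by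
  classical
  have hp : p.Prime := Fact.out
  have hinj : Function.Injective τ := Function.LeftInverse.injective hπτ
  set M := h * μ with hM
  set N := (p ^ h - 1) * p ^ M with hN
  have hq : 1 < p ^ h := Nat.one_lt_pow hh.ne' hp.one_lt
  have hMN : M ≤ N := by
    have h1 : M < p ^ M := Nat.lt_pow_self hp.one_lt
    have h2 : p ^ M ≤ (p ^ h - 1) * p ^ M := Nat.le_mul_of_pos_left _ (by omega)
    omega
  -- indicator
  have hind : ∀ y : W, (p : W) ^ M ∣ (if (p : W) ∣ y then 1 else 0) - (1 + -(y ^ N)) := by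
    intro y
    split_ifs with hy
    · have : (1 : W) - (1 + -(y ^ N)) = y ^ N := by ring
      rw [this]
      exact (pow_dvd_pow _ hMN).trans (pow_dvd_pow_of_dvd hy N)
    · have h0 : π y ≠ 0 := fun h => hy ((hπ y).1 h)
      have h1 : (p : W) ∣ y ^ (p ^ h - 1) - 1 := by
        rw [← hπ, map_sub, map_pow, map_one, ← hK, FiniteField.pow_card_sub_one_eq_one _ h0,
          sub_self]
      have h2 := dvd_sub_pow_of_dvd_sub h1 M
      rw [one_pow, ← pow_mul] at h2
      have : (0 : W) - (1 + -(y ^ N)) = y ^ N - 1 := by ring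
      rw [this]
      exact (pow_dvd_pow _ (Nat.le_succ M)).trans h2
  let Y : (Fin n → K) → Fin s → W := fun x k => MvPolynomial.eval (fun l => τ (x l)) (f k)
  have hprod : ∀ x, (p : W) ^ M ∣
      (if ∀ k, (p : W) ∣ Y x k then 1 else 0) - ∏ k, (1 + -(Y x k ^ N)) := by
    intro x
    have h1 : (if ∀ k, (p : W) ∣ Y x k then (1 : W) else 0) =
        ∏ k, (if (p : W) ∣ Y x k then 1 else 0) := by
      rw [Finset.prod_ite_zero]
      simp
    rw [h1, ← Ideal.mem_span_singleton, ← Ideal.Quotient.eq, map_prod, map_prod]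
    refine Finset.prod_congr rfl fun k _ => ?_
    rw [Ideal.Quotient.eq, Ideal.mem_span_singleton]
    exact hind _
  have hsum : (p : W) ^ M ∣ ∑ x, ∏ k, (1 + -(Y x k ^ N)) := by
    simp_rw [Finset.prod_one_add]
    rw [Finset.sum_comm]
    refine Finset.dvd_sum fun S _ => ?_
    have h1 : ∀ x, ∏ k ∈ S, -(Y x k ^ N) = (-1) ^ S.card * ∏ k : S, Y x k ^ N := by
      intro x
      rw [Finset.prod_neg, Finset.prod_coe_sort S (fun k => Y x k ^ N)]
    simp_rw [h1]
    rw [← Finset.mul_sum]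
    refine Dvd.dvd.mul_left ?_ _
    refine axk_sum hh hK τ hinj (fun k : S => f k) D hD1 (fun k => hD k) M μ ?_
    intro t ht
    refine hμ t (ht.trans ?_)
    gcongr
    rw [Finset.sum_coe_sort S (fun k => (f k).totalDegree)]
    exact Finset.sum_le_sum_of_subset (Finset.subset_univ _)
  have hcard : (p : W) ^ M ∣ ((Nat.card {x : Fin n → K // ∀ k, (p : W) ∣ Y x k} : ℕ) : W) := by
    rw [Nat.card_eq_fintype_card, Fintype.card_subtype, ← Finset.sum_boole]
    have := dvd_add (Finset.dvd_sum fun x (_ : x ∈ Finset.univ) => hprod x) hsum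
    rwa [← Finset.sum_add_distrib, Finset.sum_congr rfl fun x _ => sub_add_cancel _ _] at this
  rw [← pow_mul]
  change p ^ M ∣ Nat.card {x : Fin n → K // ∀ k, (p : W) ∣ Y x k}
  generalize Nat.card {x : Fin n → K // ∀ k, (p : W) ∣ Y x k} = c at hcard
  -- descend the divisibility to natural numbers
  clear_value M
  clear hprod hsum hind hN hMN N hM
  have hone : ∀ u : ℕ, (p : W) ∣ (u : W) → p ∣ u := by
    intro u hu
    by_contra hnu
    have hco : IsCoprime (u : ℤ) (p : ℤ) :=
      Nat.isCoprime_iff_coprime.2 ((Nat.Prime.coprime_iff_not_dvd hp).2 hnu).symm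
    obtain ⟨a, b, hab⟩ := hco
    have h1 : (a : W) * u + b * p = 1 := by exact_mod_cast congrArg (Int.cast : ℤ → W) hab
    have h2 : (p : W) ∣ 1 := by
      rw [← h1]
      exact dvd_add (Dvd.dvd.mul_left hu _) (Dvd.intro_left _ rfl)
    have := (hπ 1).2 h2
    simp at this
  induction M generalizing c with
  | zero => simp
  | succ M ih =>
    obtain ⟨u, rfl⟩ := hone c ((dvd_pow_self _ (Nat.succ_ne_zero M)).trans hcard)
    rw [pow_succ'] at hcard ⊢
    refine mul_dvd_mul_left p (ih u ?_)
    rw [Nat.cast_mul] at hcard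
    exact (mul_dvd_mul_iff_left hpW).1 hcard

/-- Uniqueness of Teichmüller expansions. -/
lemma axk_inj {p : ℕ} {K W : Type*} [Field K] [CommRing W] [IsDomain W] (hpW : (p : W) ≠ 0)
    (τ : K →* W) (π : W →+* K) (hπτ : ∀ a, π (τ a) = a) (hπp : π p = 0) (m : ℕ)
    (A B : Fin m → K)
    (h : ∑ i : Fin m, (p : W) ^ (i : ℕ) * τ (A i) = ∑ i : Fin m, (p : W) ^ (i : ℕ) * τ (B i)) :
    A = B := by
  induction m with
  | zero => exact Subsingleton.elim _ _
  | succ m ih =>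
    have hsplit : ∀ A : Fin (m + 1) → K, ∑ i : Fin (m + 1), (p : W) ^ (i : ℕ) * τ (A i) =
        τ (A 0) + p * ∑ i : Fin m, (p : W) ^ (i : ℕ) * τ (A i.succ) := by
      intro A
      rw [Fin.sum_univ_succ, Finset.mul_sum]
      simp [pow_succ', mul_assoc]
    rw [hsplit, hsplit] at h
    have h0 : A 0 = B 0 := by
      have := congrArg π h
      simpa [hπτ, hπp] using this
    rw [h0] at h
    have h1 := ih (fun i => A i.succ) (fun i => B i.succ) (mul_left_cancel₀ hpW (add_left_cancel h))
    funext i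
    refine Fin.cases h0 (fun i => congrFun h1 i) i

lemma axk_box {p h : ℕ} [Fact p.Prime] (hh : 0 < h) {K W : Type*} [Field K] [Fintype K]
    (hK : Fintype.card K = p ^ h) [CommRing W] [IsDomain W] (hpW : (p : W) ≠ 0)
    (τ : K →* W) (π : W →+* K) (hπτ : ∀ a, π (τ a) = a) (hπ : ∀ x, π x = 0 ↔ (p : W) ∣ x)
    {s n : ℕ} (f : Fin s → MvPolynomial (Fin n) W)
    (D : ℕ) (hD1 : 1 ≤ D) (hD : ∀ k, (f k).totalDegree ≤ D)
    (μ : ℕ) (hμ : ∀ t, n ≤ ∑ k, (f k).totalDegree + D * t → μ ≤ t) (m : ℕ) :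
    (p ^ h) ^ (μ + n * m) ∣ Nat.card {X : Fin n → W |
        (∃ A : Fin (m + 1) → Fin n → K, ∀ j,
          X j = ∑ i : Fin (m + 1), (p : W) ^ (i : ℕ) * τ (A i j)) ∧
        ∀ k : Fin s, (p : W) ∣ MvPolynomial.eval X (f k)} := by
  classical
  have hπp : π p = 0 := (hπ _).2 dvd_rfl
  have hred : ∀ A : Fin (m + 1) → Fin n → K, ∀ k,
      (p : W) ∣ MvPolynomial.eval (fun j => ∑ i : Fin (m + 1), (p : W) ^ (i : ℕ) * τ (A i j)) (f k) ↔
      (p : W) ∣ MvPolynomial.eval (fun j => τ (A 0 j)) (f k) := by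
    intro A k
    rw [← hπ, ← hπ]
    have : ∀ X : Fin n → W, π (MvPolynomial.eval X (f k)) =
        MvPolynomial.eval₂ π (fun j => π (X j)) (f k) := by
      intro X
      rw [← MvPolynomial.eval₂_id, MvPolynomial.eval₂_comp_left]
      rfl
    rw [this, this]
    have h2 : (fun j => π (∑ i : Fin (m + 1), (p : W) ^ (i : ℕ) * τ (A i j))) =
        fun j => π (τ (A 0 j)) := by
      funext j
      rw [Fin.sum_univ_succ]
      simp [hπp]
    rw [h2]
  let P : (Fin n → K) → Prop := fun x =>
    ∀ k, (p : W) ∣ MvPolynomial.eval (fun l => τ (x l)) (f k)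
  let g : {x // P x} × (Fin m → Fin n → K) → {X : Fin n → W |
        (∃ A : Fin (m + 1) → Fin n → K, ∀ j,
          X j = ∑ i : Fin (m + 1), (p : W) ^ (i : ℕ) * τ (A i j)) ∧
        ∀ k : Fin s, (p : W) ∣ MvPolynomial.eval X (f k)} := fun y =>
    ⟨fun j => ∑ i : Fin (m + 1),
        (p : W) ^ (i : ℕ) * τ ((Fin.cons y.1.1 y.2 : Fin (m + 1) → Fin n → K) i j),
      ⟨(Fin.cons y.1.1 y.2 : Fin (m + 1) → Fin n → K), fun j => rfl⟩,
      fun k => (hred _ k).2 (by simpa using y.1.2 k)⟩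
  have hg : Function.Bijective g := by
    constructor
    · intro y y' hyy
      have h1 : (Fin.cons y.1.1 y.2 : Fin (m + 1) → Fin n → K) = Fin.cons y'.1.1 y'.2 := by
        have h2 := congrArg Subtype.val hyy
        funext i j
        exact congrFun (axk_inj hpW τ π hπτ hπp (m + 1) _ _ (congrFun h2 j)) i
      obtain ⟨ha, hb⟩ := Fin.cons_injective2 h1
      exact Prod.ext (Subtype.ext ha) hb
    · rintro ⟨X, ⟨A, hA⟩, hX⟩
      have hXA : X = fun j => ∑ i : Fin (m + 1), (p : W) ^ (i : ℕ) * τ (A i j) := funext hA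
      subst hXA
      refine ⟨⟨⟨A 0, fun k => (hred A k).1 (hX k)⟩, fun i => A i.succ⟩, ?_⟩
      apply Subtype.ext
      funext j
      have : (Fin.cons (A 0) (fun i => A i.succ) : Fin (m + 1) → Fin n → K) = A :=
        Fin.cons_self_tail A
      simp only [g, this]
  rw [← Nat.card_congr (Equiv.ofBijective g hg), Nat.card_prod, pow_add]
  refine mul_dvd_mul (axk_main hh hK hpW τ π hπτ hπ f D hD1 hD μ hμ) ?_
  rw [Nat.card_eq_fintype_card]
  simp [hK, pow_mul]


/-- With `𝓣_m ⊆ ℤ_q^n` the level-`m` Teichmüller box (`ℤ_q ≅ W(𝔽_q)`, `q = p^h`), `m ≥ 1`,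
nonconstant `f₁,…,f_s` and `V = {X ∈ 𝓣_m : f_k(X) ≡ 0 mod p ∀k}`, one has
`ord_q(|V|) ≥ ⌈(n − Σ_k deg f_k)/max_k deg f_k⌉* + n(m−1)`, i.e. `q` to that power
divides `|V|`. -/
theorem ax_katz_teichmuller_box_level_m (p h m n s : ℕ) [Fact p.Prime]
    (hh : 0 < h) (hm : 1 ≤ m) (hs : 0 < s)
    (f : Fin s → MvPolynomial (Fin n) (WittVector p (GaloisField p h)))
    (hf : ∀ k, 0 < (f k).totalDegree) :
    (p ^ h) ^
        (⌈(((n : ℚ) - ∑ k, ((f k).totalDegree : ℚ)) /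
            ((Finset.univ.sup fun k => (f k).totalDegree : ℕ) : ℚ))⌉₊ + n * (m - 1)) ∣
      Nat.card {X : Fin n → WittVector p (GaloisField p h) |
        (∃ A : Fin m → Fin n → GaloisField p h, ∀ j,
          X j = ∑ i : Fin m,
            (p : WittVector p (GaloisField p h)) ^ (i : ℕ) *
              WittVector.teichmuller p (A i j)) ∧
        ∀ k : Fin s, (p : WittVector p (GaloisField p h)) ∣ MvPolynomial.eval X (f k)} := by
  obtain ⟨m, rfl⟩ : ∃ m', m = m' + 1 := ⟨m - 1, by omega⟩
  rw [Nat.add_sub_cancel]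
  have hK0 : Nat.card (GaloisField p h) = p ^ h := GaloisField.card p h hh.ne'
  haveI : Finite (GaloisField p h) := Nat.finite_of_card_ne_zero (by
    rw [hK0]; exact pow_ne_zero _ (Fact.out : p.Prime).ne_zero)
  letI : Fintype (GaloisField p h) := Fintype.ofFinite _
  have hK : Fintype.card (GaloisField p h) = p ^ h := by rw [← Nat.card_eq_fintype_card, hK0]
  have hle : ∀ k, (f k).totalDegree ≤ Finset.univ.sup fun k => (f k).totalDegree :=
    fun k => Finset.le_sup (f := fun k => (f k).totalDegree) (Finset.mem_univ k)
  have hD1 : 1 ≤ Finset.univ.sup fun k => (f k).totalDegree := (hf ⟨0, hs⟩).trans_le (hle _)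
  refine axk_box hh hK (WittVector.p_nonzero p _) (WittVector.teichmuller p)
    (WittVector.constantCoeff) (fun a => WittVector.teichmuller_coeff_zero p a)
    (fun x => ?_) f _ hD1 hle _ (fun t ht => ?_) m
  · rw [← Ideal.mem_span_singleton, WittVector.mem_span_p_iff_coeff_zero_eq_zero]
    rfl
  · rw [Nat.ceil_le, div_le_iff₀ (by exact_mod_cast hD1)]
    have : (n : ℚ) ≤ ∑ k, ((f k).totalDegree : ℚ) +
        ((Finset.univ.sup fun k => (f k).totalDegree : ℕ) : ℚ) * t := by exact_mod_cast ht
    linarith
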